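/- For a total PC(ID) theory (F,Π) and a consistent set M of literals that is complete over At(F∪Π): M is a model of the PC(ID) theory (F,Π) if and only if M⁺ is an answer set of the program π(F,Π) = Π^o ∪ F^r. -/

import Mathlib

set_option maxHeartbeats 1000000

attribute [local instance] Classical.propDecidable

/-! ## Atoms, literals, clauses -/

/-- Propositional atoms. -/
abbrev Atom : Type := ℕ

/-- Propositional literals: an atom or its negation. -/
inductive Lit where
  | pos : Atom → Lit
  | neg : Atom → Lit
deriving DecidableEq

/-- The atom of a literal. -/
def Lit.atom : Lit → Atom
  | .pos a => a
  | .neg a => a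

/-- The complement (dual) of a literal. -/
def Lit.compl : Lit → Lit
  | .pos a => .neg a
  | .neg a => .pos a

/-- A clause is a set of literals (read disjunctively). -/
abbrev Clause := Set Lit

/-- A CNF formula is a set of clauses. -/
abbrev CNF := Set Clause

/-- Truth of a literal in an interpretation given as the set of true atoms. -/
def litTrue (X : Set Atom) : Lit → Prop
  | .pos a => a ∈ X
  | .neg a => a ∉ X

/-- Truth of a CNF formula in an interpretation. -/
def cnfTrue (X : Set Atom) (F : CNF) : Prop := ∀ C ∈ F, ∃ l ∈ C, litTrue X l

/-- A CNF formula is satisfiable if some interpretation makes it true. -/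
def cnfSatisfiable (F : CNF) : Prop := ∃ X : Set Atom, cnfTrue X F

/-- A set `M` of literals is a model of a CNF formula if every clause contains a literal of `M`. -/
def modelCNF (M : Set Lit) (F : CNF) : Prop := ∀ C ∈ F, ∃ l ∈ C, l ∈ M

/-- A set of literals is consistent if it contains no atom together with its negation. -/
def consistentS (M : Set Lit) : Prop := ∀ a : Atom, ¬ (Lit.pos a ∈ M ∧ Lit.neg a ∈ M)

/-- `M` is complete over a set `A` of atoms: every atom of `A` occurs (possibly negated)
in `M` and no other atoms occur in `M`. -/
def completeOver (M : Set Lit) (A : Set Atom) : Prop :=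
  (∀ a ∈ A, Lit.pos a ∈ M ∨ Lit.neg a ∈ M) ∧ ∀ l ∈ M, l.atom ∈ A

/-- `M⁺`: the atoms occurring non-negated in `M`. -/
def posPart (M : Set Lit) : Set Atom := {a | Lit.pos a ∈ M}

/-- `M^A`: the literals of `M` whose atoms lie in `A`. -/
def restrictLits (M : Set Lit) (A : Set Atom) : Set Lit := {l ∈ M | l.atom ∈ A}

/-- The set of complements of the literals of `M`. -/
def compls (M : Set Lit) : Set Lit := Lit.compl '' M

/-- The atoms occurring in a CNF formula. -/
def atomsCNF (F : CNF) : Set Atom := ⋃ C ∈ F, Lit.atom '' C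

/-- A well-formed CNF formula: a finite set of finite non-empty clauses. -/
def IsCNF (F : CNF) : Prop := F.Finite ∧ ∀ C ∈ F, C.Finite ∧ C.Nonempty

/-! ## Logic programs -/

/-- A rule `a₀ ← a₁,…,a_l, not a_{l+1},…,not a_m, not not a_{m+1},…,not not a_n`.
`head = none` encodes the empty head `⊥` (a constraint). -/
structure Rule where
  head : Option Atom
  bpos : Set Atom
  bneg : Set Atom
  bnneg : Set Atom

/-- The atoms occurring in the body of a rule. -/
def Rule.bodyAtoms (r : Rule) : Set Atom := r.bpos ∪ r.bneg ∪ r.bnneg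

/-- The atoms occurring in a rule. -/
def Rule.atoms (r : Rule) : Set Atom :=
  (match r.head with | some a => ({a} : Set Atom) | none => (∅ : Set Atom)) ∪ r.bodyAtoms

/-- `s(B)` for the body of a rule: `{a₁,…,a_l, ¬a_{l+1},…,¬a_m, a_{m+1},…,a_n}`. -/
def Rule.sBody (r : Rule) : Set Lit :=
  Lit.pos '' r.bpos ∪ Lit.neg '' r.bneg ∪ Lit.pos '' r.bnneg

/-- A (propositional) logic program, as a set of rules. -/
abbrev Program := Set Rule

/-- `Head(Π)`: the set of nonempty heads of rules of `Π`. -/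
def headSet (P : Program) : Set Atom := {a | ∃ r ∈ P, r.head = some a}

/-- `At(Π)`: the set of atoms occurring in `Π`. -/
def atomsProg (P : Program) : Set Atom := ⋃ r ∈ P, r.atoms

/-- A well-formed logic program: finitely many rules, finite bodies, and
constraints have non-empty bodies. -/
def IsProgram (P : Program) : Prop :=
  P.Finite ∧ (∀ r ∈ P, r.bpos.Finite ∧ r.bneg.Finite ∧ r.bnneg.Finite) ∧
    ∀ r ∈ P, r.head = none → r.bodyAtoms.Nonempty

/-- Rule bodies, as triples (positive part, negated part, doubly negated part). -/
abbrev BodyT := Set Atom × Set Atom × Set Atom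

/-- The body of a rule. -/
def Rule.body (r : Rule) : BodyT := (r.bpos, r.bneg, r.bnneg)

/-- `s(B)` for a body triple. -/
def sBodyB (B : BodyT) : Set Lit := Lit.pos '' B.1 ∪ Lit.neg '' B.2.1 ∪ Lit.pos '' B.2.2

/-- `Bodies(Π,a)`: the set of bodies of rules of `Π` with head `a`. -/
def bodiesOf (P : Program) (a : Atom) : Set BodyT := {B | ∃ r ∈ P, r.head = some a ∧ r.body = B}

/-! ## Answer sets -/

/-- A rule survives the reduct with respect to `X`: no `not a` with `a ∈ X`
and no `not not a` with `a ∉ X` occurs in its body. -/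
def reductKeeps (r : Rule) (X : Set Atom) : Prop :=
  (∀ a ∈ r.bneg, a ∉ X) ∧ ∀ a ∈ r.bnneg, a ∈ X

/-- `Y` is closed under the positive (non-constraint) rules of the reduct of `P` w.r.t. `X`. -/
def closedUnder (P : Program) (X Y : Set Atom) : Prop :=
  ∀ r ∈ P, reductKeeps r X → r.bpos ⊆ Y → ∀ a, r.head = some a → a ∈ Y

/-- `X` is an answer set of `P`: `X` is the least model of the positive part of the
reduct `P^X`, and no constraint of the reduct has its body contained in `X`. -/
def isAnswerSet (P : Program) (X : Set Atom) : Prop :=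
  X = ⋂₀ {Y | closedUnder P X Y} ∧
    ∀ r ∈ P, r.head = none → reductKeeps r X → ¬ r.bpos ⊆ X

/-- The fact `a ←`. -/
def factRule (a : Atom) : Rule := ⟨some a, ∅, ∅, ∅⟩

/-- The choice rule `a ← not not a`. -/
def choiceRule (a : Atom) : Rule := ⟨some a, ∅, ∅, {a}⟩

/-- `X` is an input answer set of `P`: `X` is an answer set of `P ∪ (X \ Head(P))`. -/
def inputAnswerSet (P : Program) (X : Set Atom) : Prop :=
  isAnswerSet (P ∪ factRule '' (X \ headSet P)) X

/-- `Π_A`: `Π` extended with the rule `a ← not not a` for each `a ∈ A \ Head(Π)`. -/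
def progExt (P : Program) (A : Set Atom) : Program := P ∪ choiceRule '' (A \ headSet P)

/-- `At(F ∪ Π)`: the atoms occurring in `F` and `Π`. -/
def atomsTh (F : CNF) (P : Program) : Set Atom := atomsCNF F ∪ atomsProg P

/-- `Π^o = Π_{At(F∪Π)}` for the pair `[F,Π]`. -/
def progO (F : CNF) (P : Program) : Program := progExt P (atomsTh F P)

/-- A model of the SM(ASP) theory `[F,Π]`: a consistent set of literals complete over
`At(F∪Π)` that is a model of `F` and whose positive part is an input answer set of `Π`. -/
def smModel (F : CNF) (P : Program) (M : Set Lit) : Prop :=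
  consistentS M ∧ completeOver M (atomsTh F P) ∧ modelCNF M F ∧ inputAnswerSet P (posPart M)

/-! ## Unfounded sets and the well-founded operator -/

/-- `U` is unfounded on `M` with respect to `P`. -/
def unfoundedOn (U : Set Atom) (M : Set Lit) (P : Program) : Prop :=
  U ⊆ atomsProg P ∧
    ∀ a ∈ U, ∀ r ∈ P, r.head = some a →
      (∃ l ∈ r.sBody, l.compl ∈ M) ∨ ∃ b ∈ r.bpos, b ∈ U

/-- The greatest unfounded set on `M` with respect to `P`. -/
def GUS (M : Set Lit) (P : Program) : Set Atom := ⋃₀ {U | unfoundedOn U M P}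

/-- The operator `W_P` of the well-founded semantics. -/
noncomputable def WOp (P : Program) (M : Set Lit) : Set Lit :=
  if consistentS M then
    M ∪ Lit.pos '' {a | ∃ r ∈ P, r.head = some a ∧ r.sBody ⊆ M} ∪ Lit.neg '' GUS M P
  else Lit.pos '' atomsProg P ∪ Lit.neg '' atomsProg P

/-- `W^i_P(M)`: the `i`-fold application of `W_P` to `M`. -/
noncomputable def WIter (P : Program) : ℕ → Set Lit → Set Lit
  | 0, M => M
  | n + 1, M => WOp P (WIter P n M)

/-- `W^fix_P(M)`: the least fixpoint of `W_P` above `M`. -/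
def WFix (P : Program) (M : Set Lit) : Set Lit := ⋂₀ {Y | M ⊆ Y ∧ WOp P Y ⊆ Y}

/-! ## PC(ID) -/

/-- A program is weakly normal if every head is an atom. -/
def weaklyNormal (P : Program) : Prop := ∀ r ∈ P, r.head ≠ none

/-- A program is normal if every head is an atom and no double negation occurs. -/
def normalProg (P : Program) : Prop := ∀ r ∈ P, r.head ≠ none ∧ r.bnneg = ∅

/-- `O^Π = At(F∪Π) \ Head(Π)`: the open atoms of the pair `(F,Π)`. -/
def openAtomsTh (F : CNF) (P : Program) : Set Atom := atomsTh F P \ headSet P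

/-- A model of the PC(ID) theory `(F,Π)`. -/
def pcidModel (F : CNF) (P : Program) (M : Set Lit) : Prop :=
  consistentS M ∧ completeOver M (atomsTh F P) ∧ modelCNF M F ∧
    M = WFix (progO F P) (restrictLits M (openAtomsTh F P))

/-- The PC(ID) theory `(F,Π)` is total: `W^fix_{Π^o}(M^{O^Π})` assigns all atoms of
`At(F∪Π)` for every model `M` of `F`. -/
def pcidTotal (F : CNF) (P : Program) : Prop :=
  ∀ M : Set Lit, consistentS M → completeOver M (atomsTh F P) → modelCNF M F →
    ∀ a ∈ atomsTh F P,
      Lit.pos a ∈ WFix (progO F P) (restrictLits M (openAtomsTh F P)) ∨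
      Lit.neg a ∈ WFix (progO F P) (restrictLits M (openAtomsTh F P))

/-! ## Clausal forms and completion -/

/-- The clause corresponding to a rule. -/
def ruleClause (r : Rule) : Clause :=
  (match r.head with | some a => ({Lit.pos a} : Set Lit) | none => (∅ : Set Lit)) ∪
    (Lit.neg '' r.bpos ∪ Lit.pos '' r.bneg ∪ Lit.neg '' r.bnneg)

/-- `Π^cl`: the clause forms of the rules of `Π`. -/
def progCl (P : Program) : CNF := ruleClause '' P

/-- `a` is a fact in `P`: some rule with head `a` has an empty body. -/
def isFactAtom (P : Program) (a : Atom) : Prop :=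
  ∃ r ∈ P, r.head = some a ∧ r.bodyAtoms = ∅

/-- `Comp(Π)`: the clausified completion of `Π`: the clauses `Π^cl` together with all
clauses obtained by distributivity from `¬a ∨ ⋁_{B ∈ Bodies(Π,a)} B`, for every
atom `a` of `Π` that is not a fact. -/
def compClauses (P : Program) : CNF :=
  progCl P ∪
    {C | ∃ a ∈ atomsProg P, ¬ isFactAtom P a ∧
      ∃ f : BodyT → Lit, (∀ B ∈ bodiesOf P a, f B ∈ sBodyB B) ∧
        C = insert (Lit.neg a) (f '' bodiesOf P a)}

/-- The number of program literals in a body. -/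
noncomputable def bodySize (B : BodyT) : ℕ := B.1.ncard + B.2.1.ncard + B.2.2.ncard

/-- `ν` provides the literals `f_B` used by `ED-Comp`: for a singleton body, the
literal `s(l)` of its unique element; for larger bodies, fresh pairwise distinct atoms. -/
def goodNaming (P : Program) (ν : BodyT → Lit) : Prop :=
  (∀ B : BodyT, bodySize B = 1 → ν B ∈ sBodyB B) ∧
  (∀ B : BodyT, 1 < bodySize B → (∃ a : Atom, ν B = Lit.pos a) ∧ (ν B).atom ∉ atomsProg P) ∧
  ∀ B B' : BodyT, 1 < bodySize B → 1 < bodySize B' → ν B = ν B' → B = B'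

/-- `ED-Comp(P)` with respect to the naming `ν`. -/
def EDComp (ν : BodyT → Lit) (P : Program) : CNF :=
  progCl P ∪
  {C | ∃ a ∈ atomsProg P, ¬ isFactAtom P a ∧ ¬ (bodiesOf P a).Subsingleton ∧
        C = insert (Lit.neg a) (ν '' bodiesOf P a)} ∪
  {C | ∃ a ∈ atomsProg P, ∃ B : BodyT, bodiesOf P a = {B} ∧ ∃ l ∈ sBodyB B, C = {Lit.neg a, l}} ∪
  {C | ∃ a ∈ atomsProg P, bodiesOf P a = ∅ ∧ C = {Lit.neg a}} ∪
  {C | ∃ a ∈ atomsProg P, ¬ isFactAtom P a ∧ ¬ (bodiesOf P a).Subsingleton ∧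
        ∃ B ∈ bodiesOf P a, 1 < bodySize B ∧
          ((∃ l ∈ sBodyB B, C = {(ν B).compl, l}) ∨ C = insert (ν B) (compls (sBodyB B)))}

/-! ## PC(ID) theories as programs with constraints -/

/-- `C^r`: the constraint corresponding to a clause `C`. -/
def clauseRule (C : Clause) : Rule := ⟨none, {a | Lit.neg a ∈ C}, {a | Lit.pos a ∈ C}, ∅⟩

/-- `F^r = {C^r : C ∈ F}`. -/
def constraintsOf (F : CNF) : Program := clauseRule '' F

/-- `π(F,Π) = Π^o ∪ F^r`. -/
def piProg (F : CNF) (P : Program) : Program := progO F P ∪ constraintsOf F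

/-! ## Program transformations `ch(N)` and `Π(N)` -/

/-- `ch(N)`: the rules `a ← not not a` for the atoms `a` occurring in `N`. -/
def chProg (N : Set Lit) : Program := choiceRule '' (Lit.atom '' N)

/-- The body of `r` contains a program literal `l` with `s(l)` complement in `N`. -/
def ruleKilled (r : Rule) (N : Set Lit) : Prop :=
  (∃ a ∈ r.bpos, Lit.neg a ∈ N) ∨ (∃ a ∈ r.bneg, Lit.pos a ∈ N) ∨ ∃ a ∈ r.bnneg, Lit.neg a ∈ N

/-- Delete from the body of `r` every program literal `l` with `s(l) ∈ N`. -/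
def ruleReduce (r : Rule) (N : Set Lit) : Rule :=
  ⟨r.head, {a ∈ r.bpos | Lit.pos a ∉ N}, {a ∈ r.bneg | Lit.neg a ∉ N},
    {a ∈ r.bnneg | Lit.pos a ∉ N}⟩

/-- `Π(N)`: remove the rules killed by `N` and reduce the bodies of the remaining rules. -/
def progReduce (P : Program) (N : Set Lit) : Program :=
  (fun r => ruleReduce r N) '' {r ∈ P | ¬ ruleKilled r N}

/-! ## DPLL states and transition graphs -/

/-- A possibly decision-annotated literal. -/
structure ALit where
  lit : Lit
  dec : Bool
deriving DecidableEq

/-- A state: `fail` or a record (ordered list of annotated literals). -/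
inductive DpState where
  | fail : DpState
  | of : List ALit → DpState

/-- The literals of a record, in order. -/
def litsOf (M : List ALit) : List Lit := M.map ALit.lit

/-- The set of literals of a record. -/
def litSet (M : List ALit) : Set Lit := {l | l ∈ litsOf M}

/-- A record is inconsistent if it contains an atom together with its negation. -/
def inconsistentRec (M : List ALit) : Prop :=
  ∃ a : Atom, Lit.pos a ∈ litsOf M ∧ Lit.neg a ∈ litsOf M

/-- A record contains no decision literals. -/
def noDecision (M : List ALit) : Prop := ∀ x ∈ M, x.dec = false

/-- `l` is unassigned by the record `M`. -/
def unassignedBy (M : List ALit) (l : Lit) : Prop := l ∉ litsOf M ∧ l.compl ∉ litsOf M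

/-- A record relative to the set `A` of atoms: an ordered set of literals over `A`. -/
def isRecord (A : Set Atom) (M : List ALit) : Prop :=
  (litsOf M).Nodup ∧ ∀ l ∈ litsOf M, l.atom ∈ A

/-- A state relative to the set `A` of atoms. -/
def isState (A : Set Atom) : DpState → Prop
  | .fail => True
  | .of M => isRecord A M

/-- The transition rules of the DPLL graph of the clause set `G`. -/
inductive DPStep (G : CNF) : DpState → DpState → Prop
  | unitPropagate (M : List ALit) (C : Clause) (l : Lit) :
      C ∈ G → l ∈ C → (∀ k ∈ C, k ≠ l → k.compl ∈ litsOf M) →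
      DPStep G (.of M) (.of (M ++ [⟨l, false⟩]))
  | decide (M : List ALit) (l : Lit) :
      unassignedBy M l → DPStep G (.of M) (.of (M ++ [⟨l, true⟩]))
  | fail (M : List ALit) :
      inconsistentRec M → noDecision M → DPStep G (.of M) .fail
  | backtrack (Pre Q : List ALit) (l : Lit) :
      inconsistentRec (Pre ++ ⟨l, true⟩ :: Q) → noDecision Q →
      DPStep G (.of (Pre ++ ⟨l, true⟩ :: Q)) (.of (Pre ++ [⟨l.compl, false⟩]))

/-- The edges of the graph `DP_G` over states relative to `A`. -/
def dpEdge (G : CNF) (A : Set Atom) (s s' : DpState) : Prop :=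
  isState A s ∧ isState A s' ∧ DPStep G s s'

/-- The transition rules of the graph `SM(ASP)_{F,Π}`: the DPLL rules for `F ∪ Π^cl`
together with the rule Unfounded (w.r.t. `Π^o`). -/
inductive SMStep (F : CNF) (P : Program) : DpState → DpState → Prop
  | dpll {s s' : DpState} : DPStep (F ∪ progCl P) s s' → SMStep F P s s'
  | unfounded (M : List ALit) (U : Set Atom) (a : Atom) :
      consistentS (litSet M) → unfoundedOn U (litSet M) (progO F P) → a ∈ U →
      SMStep F P (.of M) (.of (M ++ [⟨Lit.neg a, false⟩]))

/-- The edges of the graph `SM(ASP)_{F,Π}`. -/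
def smEdge (F : CNF) (P : Program) (s s' : DpState) : Prop :=
  isState (atomsTh F P) s ∧ isState (atomsTh F P) s' ∧ SMStep F P s s'

/-- `F,Π^o ⊨ C`: every model of the SM(ASP) theory `[F,Π]` satisfies the clause `C`. -/
def entailsClause (F : CNF) (P : Program) (C : Clause) : Prop :=
  ∀ M : Set Lit, smModel F P M → ∃ l ∈ C, l ∈ M

/-- Augmented states: `fail`, or a record together with a set of learned clauses. -/
inductive ANode where
  | fail : ANode
  | st : List ALit → CNF → ANode

/-- A valid augmented state relative to `F` and `Π`. -/
def isANode (F : CNF) (P : Program) : ANode → Prop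
  | .fail => True
  | .st M Γ => isRecord (atomsTh F P) M ∧
      ∀ C ∈ Γ, (∀ l ∈ C, l.atom ∈ atomsTh F P) ∧ entailsClause F P C

/-- The basic transition rules of the graph `SM(ASP)L_{F,Π}`. -/
inductive SMLBasic (F : CNF) (P : Program) : ANode → ANode → Prop
  | unitPropagateLearn (M : List ALit) (Γ : CNF) (C : Clause) (l : Lit) :
      C ∈ F ∪ progCl P ∪ Γ → l ∈ C → (∀ k ∈ C, k ≠ l → k.compl ∈ litsOf M) →
      SMLBasic F P (.st M Γ) (.st (M ++ [⟨l, false⟩]) Γ)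
  | decide (M : List ALit) (Γ : CNF) (l : Lit) :
      unassignedBy M l → SMLBasic F P (.st M Γ) (.st (M ++ [⟨l, true⟩]) Γ)
  | fail (M : List ALit) (Γ : CNF) :
      inconsistentRec M → noDecision M → SMLBasic F P (.st M Γ) .fail
  | backjump (Pre Q : List ALit) (l l' : Lit) (Γ : CNF) :
      inconsistentRec (Pre ++ ⟨l, true⟩ :: Q) →
      entailsClause F P (insert l' (compls (litSet Pre))) →
      SMLBasic F P (.st (Pre ++ ⟨l, true⟩ :: Q) Γ) (.st (Pre ++ [⟨l', false⟩]) Γ)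
  | unfounded (M : List ALit) (Γ : CNF) (U : Set Atom) (a : Atom) :
      consistentS (litSet M) → unfoundedOn U (litSet M) (progO F P) → a ∈ U →
      SMLBasic F P (.st M Γ) (.st (M ++ [⟨Lit.neg a, false⟩]) Γ)

/-- The transition rule Learn of `SM(ASP)L_{F,Π}`. -/
def learnStep (F : CNF) (P : Program) (n n' : ANode) : Prop :=
  ∃ (M : List ALit) (Γ : CNF) (C : Clause),
    n = ANode.st M Γ ∧ n' = ANode.st M (insert C Γ) ∧
    (∀ l ∈ C, l.atom ∈ atomsCNF F) ∧ entailsClause F P C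

/-- The transition rules of `SM(ASP)L_{F,Π}`: the basic rules and Learn. -/
def SMLStep (F : CNF) (P : Program) (n n' : ANode) : Prop :=
  SMLBasic F P n n' ∨ learnStep F P n n'

/-- The edges of the graph `SM(ASP)L_{F,Π}`. -/
def smlEdge (F : CNF) (P : Program) (n n' : ANode) : Prop :=
  isANode F P n ∧ isANode F P n' ∧ SMLStep F P n n'

/-- The edges of `SM(ASP)L_{F,Π}` justified by a basic transition rule. -/
def smlBasicEdge (F : CNF) (P : Program) (n n' : ANode) : Prop :=
  isANode F P n ∧ isANode F P n' ∧ SMLBasic F P n n'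

/-- `F` is a `Π`-safe set of clauses. -/
def piSafe (F : CNF) (P : Program) : Prop :=
  (∀ a ∈ atomsProg P \ headSet P, ∀ X : Set Atom, cnfTrue X F → a ∉ X) ∧
  ∀ X : Set Atom, isAnswerSet P X →
    ∃ M : Set Lit, consistentS M ∧ completeOver M (atomsTh F P) ∧ modelCNF M F ∧
      X = posPart M ∩ headSet P

theorem atomsProg_progO_subset (F : CNF) (P : Program) :
    atomsProg (progO F P) ⊆ atomsTh F P := by
  intro a ha
  simp only [atomsProg, Set.mem_iUnion] at ha
  obtain ⟨r, hr, har⟩ := ha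
  rcases hr with hr | ⟨b, hb, rfl⟩
  · exact Or.inr (Set.mem_biUnion hr har)
  · have hab : a = b := by simpa [Rule.atoms, Rule.bodyAtoms, choiceRule] using har
    exact hab ▸ hb.1

theorem head_mem_atomsProg {P : Program} {r : Rule} {a : Atom} (hr : r ∈ P)
    (ha : r.head = some a) : a ∈ atomsProg P :=
  Set.mem_biUnion hr (by simp [Rule.atoms, ha])

theorem bneg_mem_atomsProg {P : Program} {r : Rule} {a : Atom} (hr : r ∈ P)
    (ha : a ∈ r.bneg) : a ∈ atomsProg P :=
  Set.mem_biUnion hr (by simp [Rule.atoms, Rule.bodyAtoms, ha])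

theorem weaklyNormal_progO (F : CNF) {P : Program} (hwn : weaklyNormal P) :
    weaklyNormal (progO F P) := by
  rintro r (hr | ⟨b, -, rfl⟩)
  · exact hwn r hr
  · simp [choiceRule]

theorem GUS_subset_atomsProg (M : Set Lit) (P : Program) : GUS M P ⊆ atomsProg P :=
  Set.sUnion_subset fun _ hU => hU.1

theorem GUS_mono {M N : Set Lit} (h : M ⊆ N) (P : Program) : GUS M P ⊆ GUS N P := by
  refine Set.sUnion_subset fun U hU => Set.subset_sUnion_of_mem ⟨hU.1, fun a ha r hr hra => ?_⟩
  exact (hU.2 a ha r hr hra).imp_left fun ⟨l, hl, hlM⟩ => ⟨l, hl, h hlM⟩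

theorem WOp_subset_iff {P : Program} {M Y : Set Lit} (hM : consistentS M) :
    WOp P M ⊆ Y ↔ M ⊆ Y ∧ (∀ r ∈ P, ∀ a, r.head = some a → r.sBody ⊆ M → Lit.pos a ∈ Y) ∧
      ∀ a ∈ GUS M P, Lit.neg a ∈ Y := by
  rw [WOp, if_pos hM, Set.union_subset_iff, Set.union_subset_iff, Set.image_subset_iff,
    Set.image_subset_iff, and_assoc]
  refine and_congr_right fun _ => and_congr ⟨?_, ?_⟩ Iff.rfl
  · exact fun h r hr a ha hs => h ⟨r, hr, ha, hs⟩
  · exact fun h a ⟨r, hr, ha, hs⟩ => h r hr a ha hs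

/-- `W_P` is monotone along a consistent set of literals over the atoms of `P`. -/
theorem WOp_mono {P : Program} {M N : Set Lit} (hM : consistentS M)
    (hMA : ∀ l ∈ M, l.atom ∈ atomsProg P) (h : M ⊆ N) : WOp P M ⊆ WOp P N := by
  by_cases hN : consistentS N
  · obtain ⟨h1, h2, h3⟩ := (WOp_subset_iff hN).1 (Set.Subset.refl (WOp P N))
    exact (WOp_subset_iff hM).2 ⟨h.trans h1, fun r hr a ha hs => h2 r hr a ha (hs.trans h),
      fun a ha => h3 a (GUS_mono h P ha)⟩
  · rw [WOp_subset_iff hM, WOp, if_neg hN]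
    refine ⟨fun l hl => ?_, fun r hr a ha _ => ?_, fun a ha => ?_⟩
    · cases l with
      | pos a => exact Or.inl ⟨a, hMA _ hl, rfl⟩
      | neg a => exact Or.inr ⟨a, hMA _ hl, rfl⟩
    · exact Or.inl ⟨a, head_mem_atomsProg hr ha, rfl⟩
    · exact Or.inr ⟨a, GUS_subset_atomsProg M P ha, rfl⟩

theorem atomsTh_subset_atomsProg_progO (F : CNF) (P : Program) :
    atomsTh F P ⊆ atomsProg (progO F P) := by
  intro a ha
  by_cases h : a ∈ headSet P
  · obtain ⟨r, hr, hra⟩ := h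
    exact head_mem_atomsProg (Or.inl hr) hra
  · exact head_mem_atomsProg (r := choiceRule a) (Or.inr ⟨a, ⟨ha, h⟩, rfl⟩) rfl

/-- A body is true in a consistent set that decides its negated atoms iff the rule survives the
reduct and its positive part is true. -/
theorem sBody_subset_iff {M : Set Lit} {r : Rule} (hM : consistentS M)
    (hr : ∀ a ∈ r.bneg, Lit.pos a ∈ M ∨ Lit.neg a ∈ M) :
    r.sBody ⊆ M ↔ reductKeeps r (posPart M) ∧ r.bpos ⊆ posPart M := by
  simp only [Rule.sBody, Set.union_subset_iff, Set.image_subset_iff]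
  constructor
  · rintro ⟨⟨h1, h2⟩, h3⟩
    exact ⟨⟨fun a ha hp => hM a ⟨hp, h2 ha⟩, fun a ha => h3 ha⟩, h1⟩
  · rintro ⟨⟨h2, h3⟩, h1⟩
    exact ⟨⟨h1, fun a ha => (hr a ha).resolve_left (h2 a ha)⟩, h3⟩

theorem closedUnder_piProg_iff (F : CNF) (P : Program) (X Y : Set Atom) :
    closedUnder (piProg F P) X Y ↔ closedUnder (progO F P) X Y := by
  refine ⟨fun h r hr => h r (Or.inl hr), ?_⟩
  rintro h r (hr | ⟨C, -, rfl⟩) hk hb a ha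
  · exact h r hr hk hb a ha
  · simp [clauseRule] at ha

/-- A consistent set deciding the atoms of a CNF formula is a model of it iff no
constraint of `F^r` is violated. -/
theorem modelCNF_iff_constraints {F : CNF} {M : Set Lit} (hM : consistentS M)
    (hF : ∀ a ∈ atomsCNF F, Lit.pos a ∈ M ∨ Lit.neg a ∈ M) :
    modelCNF M F ↔
      ∀ r ∈ constraintsOf F, reductKeeps r (posPart M) → ¬ r.bpos ⊆ posPart M := by
  constructor
  · rintro h _ ⟨C, hC, rfl⟩ hk hb
    obtain ⟨l, hl, hlM⟩ := h C hC
    cases l with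
    | pos a => exact hk.1 a hl hlM
    | neg a => exact hM a ⟨hb hl, hlM⟩
  · intro h C hC
    by_contra! hno
    refine h _ ⟨C, hC, rfl⟩ ⟨fun a ha => hno _ ha, by simp [clauseRule]⟩ fun a ha => ?_
    exact (hF a (Set.mem_biUnion hC ⟨_, ha, rfl⟩)).resolve_right (hno _ ha)

/-- The least fixpoint above `N` is closed under `W_P` when it is consistent and over the
atoms of `P`. -/
theorem WOp_WFix_subset {P : Program} {N : Set Lit} (hcons : consistentS (WFix P N))
    (hA : ∀ l ∈ WFix P N, l.atom ∈ atomsProg P) : WOp P (WFix P N) ⊆ WFix P N :=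
  Set.subset_sInter fun _ hY => (WOp_mono hcons hA (Set.sInter_subset_of_mem hY)).trans hY.2

theorem posPart_eq_sInter_of_eq_WFix {F : CNF} {P : Program} {M : Set Lit}
    (hcons : consistentS M) (hcomp : completeOver M (atomsTh F P))
    (hM : M = WFix (progO F P) (restrictLits M (openAtomsTh F P))) :
    posPart M = ⋂₀ {Y | closedUnder (progO F P) (posPart M) Y} := by
  have hdec : ∀ r ∈ progO F P, ∀ a ∈ r.bneg, Lit.pos a ∈ M ∨ Lit.neg a ∈ M := fun r hr a ha =>
    hcomp.1 a (atomsProg_progO_subset F P (bneg_mem_atomsProg hr ha))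
  have hfix : WOp (progO F P) M ⊆ M := by
    have h := WOp_WFix_subset (hM ▸ hcons)
      (hM ▸ fun l hl => atomsTh_subset_atomsProg_progO F P (hcomp.2 l hl))
    rwa [← hM] at h
  obtain ⟨-, hhead, hgus⟩ := (WOp_subset_iff hcons).1 hfix
  refine Set.Subset.antisymm (Set.subset_sInter fun Y hY => ?_) (Set.sInter_subset_of_mem ?_)
  · let Z : Set Lit := {l ∈ M | ∀ a, l = Lit.pos a → a ∈ Y}
    have hZM : Z ⊆ M := Set.sep_subset _ _
    have hZ : consistentS Z := fun a h => hcons a ⟨hZM h.1, hZM h.2⟩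
    have hMZ : M ⊆ Z := by
      conv_lhs => rw [hM]
      refine Set.sInter_subset_of_mem ⟨?_, (WOp_subset_iff hZ).2 ⟨Set.Subset.refl _, ?_, ?_⟩⟩
      · rintro l ⟨hl, hlo⟩
        refine ⟨hl, ?_⟩
        rintro a rfl
        refine hY (choiceRule a) (Or.inr ⟨a, hlo, rfl⟩) ⟨by simp [choiceRule], ?_⟩
          (by simp [choiceRule]) a rfl
        rintro b rfl
        exact hl
      · intro r hr a ha hs
        refine ⟨hhead r hr a ha (hs.trans hZM), ?_⟩
        rintro b hb
        cases hb
        refine hY r hr ((sBody_subset_iff hcons (hdec r hr)).1 (hs.trans hZM)).1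
          (fun c hc => ?_) a ha
        exact (hs (Or.inl (Or.inl ⟨c, hc, rfl⟩))).2 c rfl
      · exact fun a ha => ⟨hgus a (GUS_mono hZM _ ha), fun b hb => by cases hb⟩
    exact fun a ha => (hMZ ha).2 a rfl
  · intro r hr hk hb a ha
    exact hhead r hr a ha ((sBody_subset_iff hcons (hdec r hr)).2 ⟨hk, hb⟩)

theorem WFix_subset_of_posPart_eq_sInter {F : CNF} {P : Program} {M : Set Lit}
    (hcons : consistentS M) (hcomp : completeOver M (atomsTh F P))
    (hX : posPart M = ⋂₀ {Y | closedUnder (progO F P) (posPart M) Y}) :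
    WFix (progO F P) (restrictLits M (openAtomsTh F P)) ⊆ M := by
  have hdec : ∀ r ∈ progO F P, ∀ a ∈ r.bneg, Lit.pos a ∈ M ∨ Lit.neg a ∈ M := fun r hr a ha =>
    hcomp.1 a (atomsProg_progO_subset F P (bneg_mem_atomsProg hr ha))
  have hleast : ∀ Y, closedUnder (progO F P) (posPart M) Y → posPart M ⊆ Y := fun Y hY => by
    conv_lhs => rw [hX]
    exact Set.sInter_subset_of_mem hY
  have hclosed : closedUnder (progO F P) (posPart M) (posPart M) := by
    intro r hr hk hb a ha
    rw [hX]
    exact fun Y hY => hY r hr hk (hb.trans (hleast Y hY)) a ha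
  refine Set.sInter_subset_of_mem
    ⟨Set.sep_subset _ _, (WOp_subset_iff hcons).2 ⟨Set.Subset.refl _, ?_, ?_⟩⟩
  · intro r hr a ha hs
    obtain ⟨hk, hb⟩ := (sBody_subset_iff hcons (hdec r hr)).1 hs
    exact hclosed r hr hk hb a ha
  · rintro a ⟨U, hU, haU⟩
    refine (hcomp.1 a (atomsProg_progO_subset F P (hU.1 haU))).resolve_left fun haM => ?_
    refine (hleast (posPart M \ U) ?_ haM).2 haU
    intro r hr hk hb c hc
    have hbX : r.bpos ⊆ posPart M := hb.trans Set.sdiff_subset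
    refine ⟨hclosed r hr hk hbX c hc, fun hcU => ?_⟩
    rcases hU.2 c hcU r hr hc with ⟨l, hl, hlM⟩ | ⟨b, hbr, hbU⟩
    · have hl' := (sBody_subset_iff hcons (hdec r hr)).2 ⟨hk, hbX⟩ hl
      cases l with
      | pos d => exact hcons d ⟨hl', hlM⟩
      | neg d => exact hcons d ⟨hlM, hl'⟩
    · exact (hb hbr).2 hbU

/-- For a total PC(ID) theory `(F,Π)` and a consistent set `M` of literals
complete over `At(F∪Π)`: `M` is a model of `(F,Π)` iff `M⁺` is an answer set of
`π(F,Π) = Π^o ∪ F^r`. -/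
theorem pcid_model_iff_answer_set_piProg (F : CNF) (P : Program)
    (hF : IsCNF F) (hP : IsProgram P) (hwn : weaklyNormal P) (htot : pcidTotal F P)
    (M : Set Lit) (hcons : consistentS M) (hcomp : completeOver M (atomsTh F P)) :
    pcidModel F P M ↔ isAnswerSet (piProg F P) (posPart M) := by
  have hcnf := modelCNF_iff_constraints (F := F) hcons fun a ha => hcomp.1 a (Or.inl ha)
  simp only [isAnswerSet, closedUnder_piProg_iff]
  constructor
  · rintro ⟨-, -, hMF, hM⟩
    refine ⟨posPart_eq_sInter_of_eq_WFix hcons hcomp hM, ?_⟩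
    rintro r (hr | hr) hnone
    · exact absurd hnone (weaklyNormal_progO F hwn r hr)
    · exact hcnf.1 hMF r hr
  · rintro ⟨hX, hconstr⟩
    have hMF : modelCNF M F := by
      refine hcnf.2 fun r hr => hconstr r (Or.inr hr) ?_
      obtain ⟨C, -, rfl⟩ := hr
      rfl
    have hsub := WFix_subset_of_posPart_eq_sInter hcons hcomp hX
    refine ⟨hcons, hcomp, hMF, Set.Subset.antisymm (fun l hl => ?_) hsub⟩
    have h := htot M hcons hcomp hMF l.atom (hcomp.2 l hl)
    cases l with
    | pos a => exact h.resolve_right fun hn => hcons a ⟨hl, hsub hn⟩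
    | neg a => exact h.resolve_left fun hp => hcons a ⟨hsub hp, hl⟩
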